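/- No cograph has an adjacency eigenvalue in the open interval (−1, 0): if G is a cograph and λ is an eigenvalue of its adjacency matrix, then λ ≤ −1 or λ ≥ 0. -/

import Mathlib

open scoped Classical

/-- A cograph is a finite simple graph with no induced path on four vertices. -/
def IsCograph {V : Type*} (G : SimpleGraph V) : Prop :=
  ¬ Nonempty (SimpleGraph.pathGraph 4 ↪g G)

/-- Elementary form of `P₄`-freeness. -/
def NoP4 {V : Type*} (G : SimpleGraph V) : Prop :=
  ∀ a b c d, G.Adj a b → G.Adj b c → G.Adj c d → ¬ G.Adj a c → ¬ G.Adj b d → ¬ G.Adj a d → False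

theorem IsCograph.noP4 {V : Type*} {G : SimpleGraph V} (h : IsCograph G) : NoP4 G := by
  intro a b c d hab hbc hcd hac hbd had
  apply h
  have h1 : a ≠ b := hab.ne
  have h2 : b ≠ c := hbc.ne
  have h3 : c ≠ d := hcd.ne
  have h4 : a ≠ c := by rintro rfl; exact had hcd
  have h5 : b ≠ d := by rintro rfl; exact had hab
  have h6 : a ≠ d := by rintro rfl; exact hac hcd.symm
  refine ⟨⟨⟨![a, b, c, d], ?_⟩, ?_⟩⟩
  · intro i j hij
    fin_cases i <;> fin_cases j <;> simp_all
  · intro i j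
    change G.Adj (![a, b, c, d] i) (![a, b, c, d] j) ↔ _
    fin_cases i <;> fin_cases j <;>
      simp_all [SimpleGraph.pathGraph_adj, G.adj_comm b a, G.adj_comm c b, G.adj_comm d c,
        G.adj_comm c a, G.adj_comm d b, G.adj_comm d a]

theorem NoP4.compl {V : Type*} {G : SimpleGraph V} (h : NoP4 G) : NoP4 Gᶜ := by
  intro a b c d hab hbc hcd hac hbd had
  have h4 : a ≠ c := by rintro rfl; exact had hcd
  have h5 : b ≠ d := by rintro rfl; exact had hab
  have h6 : a ≠ d := by rintro rfl; exact hac hcd.symm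
  simp only [SimpleGraph.compl_adj, not_and, not_not] at *
  exact h b d a c (hbd h5) (had h6).symm (hac h4) (fun h => hab.2 h.symm)
    (fun h => hcd.2 h.symm) hbc.2

/-- `S` splits into two nonempty parts with no edges between them. -/
def Spl {V : Type*} (G : SimpleGraph V) (S : Finset V) : Prop :=
  ∃ A B : Finset V, A.Nonempty ∧ B.Nonempty ∧ Disjoint A B ∧ A ∪ B = S ∧
    ∀ a ∈ A, ∀ b ∈ B, ¬ G.Adj a b

theorem spl_of_subset {V : Type*} {G : SimpleGraph V} {S A : Finset V} (hA : A ⊆ S) (x y : V)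
    (hx : x ∈ A) (hy : y ∈ S) (hy' : y ∉ A) (h : ∀ a ∈ A, ∀ b ∈ S, b ∉ A → ¬ G.Adj a b) :
    Spl G S := by
  refine ⟨A, S \ A, ⟨x, hx⟩, ⟨y, by simp [hy, hy']⟩, Finset.disjoint_sdiff,
    Finset.union_sdiff_of_subset hA, ?_⟩
  intro a ha b hb
  rw [Finset.mem_sdiff] at hb
  exact h a ha b hb.1 hb.2

theorem spl_step {V : Type*} {G : SimpleGraph V} (h : NoP4 G) {v : V} {T : Finset V}
    (hv : v ∉ T) (hT : Spl G T) : Spl G (insert v T) ∨ Spl Gᶜ (insert v T) := by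
  obtain ⟨A₀, B₀, ⟨a₀, ha₀⟩, ⟨b₀, hb₀⟩, hd, rfl, hn⟩ := hT
  set T := A₀ ∪ B₀ with hTdef
  have ha₀T : a₀ ∈ T := Finset.mem_union_left _ ha₀
  have hb₀T : b₀ ∈ T := Finset.mem_union_right _ hb₀
  by_cases hall : ∀ b ∈ T, G.Adj v b
  · right
    refine spl_of_subset (A := {v}) (by simp) v a₀ (by simp) (by simp [ha₀T]) (by grind) ?_
    intro a ha b hb hb'
    have : a = v := by simpa using ha
    subst this
    have hbT : b ∈ T := by grind
    simp [hall b hbT]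
  left
  push Not at hall
  obtain ⟨b, hbT, hvb⟩ := hall
  let P : Finset V → Prop := fun A => b ∈ A ∧ A ≠ T ∧ ∀ x ∈ A, ∀ y ∈ T, y ∉ A → ¬ G.Adj x y
  have hex : (T.powerset.filter P).Nonempty := by
    have hdis := Finset.disjoint_left.mp hd
    rcases Finset.mem_union.mp hbT with hb | hb
    · refine ⟨A₀, Finset.mem_filter.mpr ⟨Finset.mem_powerset.mpr Finset.subset_union_left, hb, ?_, ?_⟩⟩
      · intro he; rw [← he] at hb₀T; exact hdis hb₀T hb₀
      · intro x hx y hy hy'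
        exact hn x hx y (by grind)
    · refine ⟨B₀, Finset.mem_filter.mpr ⟨Finset.mem_powerset.mpr Finset.subset_union_right, hb, ?_, ?_⟩⟩
      · intro he; rw [← he] at ha₀T; exact hdis ha₀ ha₀T
      · intro x hx y hy hy' hxy
        exact hn y (by grind) x hx hxy.symm
  obtain ⟨A, hA, hmin⟩ := Finset.exists_min_image _ Finset.card hex
  obtain ⟨hAT, hbA, hne, hcl⟩ := Finset.mem_filter.mp hA
  rw [Finset.mem_powerset] at hAT
  obtain ⟨t, htT, htA⟩ : ∃ t ∈ T, t ∉ A := by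
    by_contra hc
    push Not at hc
    exact hne (Finset.Subset.antisymm hAT hc)
  by_cases h1 : ∀ a ∈ A, ¬ G.Adj v a
  · refine spl_of_subset (A := A) (by grind) b t hbA (by grind) htA ?_
    intro a ha y hy hyA hay
    rcases Finset.mem_insert.mp hy with rfl | hy
    · exact h1 a ha hay.symm
    · exact hcl a ha y hy hyA hay
  by_cases h2 : ∀ c ∈ T, c ∉ A → ¬ G.Adj v c
  · refine spl_of_subset (A := T \ A) (by grind) t v (by grind) (by grind) (by grind) ?_
    intro a ha y hy hyA hay
    rw [Finset.mem_sdiff] at ha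
    rcases Finset.mem_insert.mp hy with rfl | hy
    · exact h2 a ha.1 ha.2 hay.symm
    · exact hcl y (by grind) a ha.1 ha.2 hay.symm
  exfalso
  push Not at h1 h2
  obtain ⟨a₁, ha₁, hva₁⟩ := h1
  obtain ⟨c, hcT, hcA, hvc⟩ := h2
  by_cases h3 : ∃ a ∈ A, ∃ b' ∈ A, G.Adj v a ∧ ¬ G.Adj v b' ∧ G.Adj b' a
  · obtain ⟨a, ha, b', hb', hva, hvb', hba⟩ := h3
    exact h b' a v c hba hva.symm hvc (fun h => hvb' h.symm) (hcl a ha c hcT hcA)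
      (hcl b' hb' c hcT hcA)
  · push Not at h3
    have hmem : A.filter (fun x => ¬ G.Adj v x) ∈ T.powerset.filter P := by
      refine Finset.mem_filter.mpr ⟨?_, ?_, ?_, ?_⟩
      · rw [Finset.mem_powerset]; exact (Finset.filter_subset _ _).trans hAT
      · simp [hbA, hvb]
      · intro he; rw [← he] at htT; exact htA (Finset.mem_filter.mp htT).1
      · intro x hx y hy hyn hxy
        rw [Finset.mem_filter] at hx
        by_cases hyA : y ∈ A
        · exact h3 y hyA x hx.1 (by by_contra hc; exact hyn (by simp [hyA, hc])) hx.2 hxy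
        · exact hcl x hx.1 y hy hyA hxy
    have hlt : (A.filter (fun x => ¬ G.Adj v x)).card < A.card := by
      apply Finset.card_lt_card
      refine Finset.filter_ssubset.mpr ⟨a₁, ha₁, by simpa using hva₁⟩
    exact absurd (hmin _ hmem) (by omega)

theorem seinsche {V : Type*} {G : SimpleGraph V} (h : NoP4 G) (S : Finset V) :
    2 ≤ S.card → Spl G S ∨ Spl Gᶜ S := by
  induction S using Finset.induction_on with
  | empty => simp
  | insert v T hv ih =>
    intro hc
    rw [Finset.card_insert_of_notMem hv] at hc
    by_cases hT : 2 ≤ T.card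
    · rcases ih hT with h1 | h1
      · exact spl_step h hv h1
      · have := spl_step h.compl hv h1
        rw [compl_compl] at this
        exact this.symm
    · obtain ⟨w, rfl⟩ := Finset.card_eq_one.mp (show T.card = 1 by omega)
      have hvw : v ≠ w := by simpa using hv
      by_cases hadj : G.Adj v w
      · right
        refine ⟨{v}, {w}, by simp, by simp, by simpa using hvw, by ext; simp, ?_⟩
        simp [hadj]
      · left
        refine ⟨{v}, {w}, by simp, by simp, by simpa using hvw, by ext; simp, ?_⟩
        simp [hadj]

theorem main_aux {V : Type*} {G : SimpleGraph V} (h : NoP4 G) (d : ℝ) (hd0 : 0 < d) (hd1 : d < 1)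
    (n : ℕ) : ∀ S : Finset V, S.card = n → S.Nonempty → ∃ g : ℝ, 1 < g ∧ ∀ (x : V → ℝ) (c : ℝ),
      (∀ v ∈ S, d * x v + ∑ w ∈ S, (if G.Adj v w then x w else 0) = c) →
      ∑ v ∈ S, x v = g * c ∧ (c = 0 → ∀ v ∈ S, x v = 0) := by
  induction n using Nat.strong_induction_on with
  | _ n ih =>
  intro S hn hS
  by_cases h2 : 2 ≤ S.card
  · rcases seinsche h S h2 with ⟨A, B, hA, hB, hd, rfl, hne⟩ | ⟨A, B, hA, hB, hd, rfl, hne⟩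
    all_goals
      rw [Finset.card_union_of_disjoint hd] at hn
      have hAc := hA.card_pos
      have hBc := hB.card_pos
      obtain ⟨g₁, hg₁, H₁⟩ := ih A.card (by omega) A rfl hA
      obtain ⟨g₂, hg₂, H₂⟩ := ih B.card (by omega) B rfl hB
    · refine ⟨g₁ + g₂, by linarith, fun x c hx => ?_⟩
      obtain ⟨e₁, z₁⟩ := H₁ x c (by
        intro v hv
        rw [← hx v (Finset.mem_union_left _ hv), Finset.sum_union hd]
        rw [Finset.sum_eq_zero (s := B), add_zero]
        intro w hw; rw [if_neg (hne v hv w hw)])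
      obtain ⟨e₂, z₂⟩ := H₂ x c (by
        intro v hv
        rw [← hx v (Finset.mem_union_right _ hv), Finset.sum_union hd]
        rw [Finset.sum_eq_zero (s := A), zero_add]
        intro w hw; rw [if_neg (fun hh => hne w hw v hv hh.symm)])
      refine ⟨by rw [Finset.sum_union hd, e₁, e₂]; ring, fun hc v hv => ?_⟩
      rcases Finset.mem_union.mp hv with hv | hv
      · exact z₁ hc v hv
      · exact z₂ hc v hv
    · have hdis := Finset.disjoint_left.mp hd
      have hadj : ∀ a ∈ A, ∀ b ∈ B, G.Adj a b := by
        intro a ha b hb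
        have h1 := hne a ha b hb
        have : a ≠ b := by rintro rfl; exact hdis ha hb
        simpa [this] using h1
      have hpos : 0 < g₁ * g₂ - 1 := by nlinarith
      refine ⟨(2 * g₁ * g₂ - g₁ - g₂) / (g₁ * g₂ - 1), ?_, fun x c hx => ?_⟩
      · rw [lt_div_iff₀ hpos]; nlinarith
      obtain ⟨e₁, z₁⟩ := H₁ x (c - ∑ w ∈ B, x w) (by
        intro v hv
        rw [← hx v (Finset.mem_union_left _ hv), Finset.sum_union hd]
        rw [Finset.sum_congr (s₁ := B) rfl (fun w hw => if_pos (hadj v hv w hw))]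
        ring)
      obtain ⟨e₂, z₂⟩ := H₂ x (c - ∑ w ∈ A, x w) (by
        intro v hv
        rw [← hx v (Finset.mem_union_right _ hv), Finset.sum_union hd]
        rw [Finset.sum_congr (s₁ := A) rfl (fun w hw => if_pos (hadj w hw v hv).symm)]
        ring)
      rw [Finset.sum_union hd]
      generalize ∑ w ∈ A, x w = s at *
      generalize ∑ w ∈ B, x w = t at *
      have es : (g₁ * g₂ - 1) * s = g₁ * (g₂ - 1) * c := by
        rw [e₂] at e₁; linear_combination -e₁
      have et : (g₁ * g₂ - 1) * t = g₂ * (g₁ - 1) * c := by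
        rw [e₁] at e₂; linear_combination -e₂
      refine ⟨?_, fun hc v hv => ?_⟩
      · rw [div_mul_eq_mul_div, eq_div_iff hpos.ne']
        linear_combination es + et
      · have hs : s = 0 := by simpa [hc, hpos.ne'] using es
        have ht : t = 0 := by simpa [hc, hpos.ne'] using et
        rcases Finset.mem_union.mp hv with hv | hv
        · exact z₁ (by simp [hc, ht]) v hv
        · exact z₂ (by simp [hc, hs]) v hv
  · have := hS.card_pos
    obtain ⟨w, rfl⟩ := Finset.card_eq_one.mp (show S.card = 1 by omega)
    refine ⟨1 / d, by rw [lt_div_iff₀ hd0]; linarith, fun x c hx => ?_⟩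
    have hw := hx w (by simp)
    simp only [Finset.sum_singleton, SimpleGraph.irrefl, if_false, add_zero] at hw ⊢
    subst hw
    refine ⟨by field_simp, fun hc v hv => ?_⟩
    have : v = w := by simpa using hv
    subst this
    simpa [hd0.ne'] using hc

/-- No cograph has an adjacency eigenvalue in the open interval `(-1, 0)`. -/
theorem cograph_no_eigenvalue_in_Ioo {V : Type*} [Fintype V] (G : SimpleGraph V)
    (hG : IsCograph G) (μ : ℝ)
    (hμ : Module.End.HasEigenvalue (Matrix.toLin' (G.adjMatrix ℝ)) μ) :
    μ ≤ -1 ∨ 0 ≤ μ := by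
  by_contra hc
  push Not at hc
  obtain ⟨x, hx⟩ := hμ.exists_hasEigenvector
  have hx0 := hx.2
  have hxe := hx.apply_eq_smul
  obtain ⟨v₀, -⟩ := Function.ne_iff.mp hx0
  obtain ⟨g, -, H⟩ := main_aux hG.noP4 (-μ) (by linarith) (by linarith) _ Finset.univ rfl
    ⟨v₀, Finset.mem_univ _⟩
  apply hx0
  funext v
  refine (H x 0 ?_).2 rfl v (Finset.mem_univ _)
  intro v _
  have := congrFun hxe v
  simp only [Matrix.toLin'_apply, Matrix.mulVec, dotProduct, SimpleGraph.adjMatrix_apply,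
    ite_mul, one_mul, zero_mul, Pi.smul_apply, smul_eq_mul] at this
  rw [this]; ring
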